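/- Let 𝒜 : ℝ^{m×n} → ℝ^p be a linear operator satisfying the restricted isometry property on rank-2r matrices with parameter δ_{2r}. Then for any two matrices X, Y ∈ ℝ^{m×n}, each of rank at most r, one has |Σ_{i=1}^p ⟨A_i, X⟩·⟨A_i, Y⟩ − ⟨X, Y⟩| ≤ δ_{2r}·‖X‖_F·‖Y‖_F. -/

import Mathlib

open Matrix BigOperators

noncomputable section

/-- Trace inner product `⟨X, Y⟩ = trace (Xᵀ * Y) = ∑ᵢⱼ Xᵢⱼ Yᵢⱼ`. -/
def ip {α β : Type*} [Fintype α] [Fintype β] (X Y : Matrix α β ℝ) : ℝ :=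
  ∑ i, ∑ j, X i j * Y i j

/-- Frobenius norm. -/
def fnorm {α β : Type*} [Fintype α] [Fintype β] (X : Matrix α β ℝ) : ℝ :=
  Real.sqrt (∑ i, ∑ j, X i j ^ 2)

/-- Euclidean (ℓ₂) norm of a vector. -/
def vnorm {α : Type*} [Fintype α] (x : α → ℝ) : ℝ :=
  Real.sqrt (∑ i, x i ^ 2)

/-- The linear operator `𝒜(X)ᵢ = ⟨Aᵢ, X⟩` satisfies the restricted isometry property on
rank-`k` matrices with parameter `δ`. -/
def RIP {m n p : ℕ} (A : Fin p → Matrix (Fin m) (Fin n) ℝ) (k : ℕ) (δ : ℝ) : Prop :=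
  ∀ X : Matrix (Fin m) (Fin n) ℝ, X.rank ≤ k →
    (1 - δ) * fnorm X ^ 2 ≤ ∑ i, ip (A i) X ^ 2 ∧
      ∑ i, ip (A i) X ^ 2 ≤ (1 + δ) * fnorm X ^ 2

/-- Vertical stacking `[U; V]`. -/
def stack {m n r : ℕ} (U : Matrix (Fin m) (Fin r) ℝ) (V : Matrix (Fin n) (Fin r) ℝ) :
    Matrix (Fin m ⊕ Fin n) (Fin r) ℝ :=
  Matrix.fromRows U V

/-- For `Z = [Z_U; Z_V]`, `tilde Z = [Z_U; -Z_V]` (negate the bottom block). -/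
def tilde {m n r : ℕ} (Z : Matrix (Fin m ⊕ Fin n) (Fin r) ℝ) :
    Matrix (Fin m ⊕ Fin n) (Fin r) ℝ :=
  Matrix.of (Sum.elim (fun i j => Z (Sum.inl i) j) (fun i j => -Z (Sum.inr i) j))

/-- `Bᵢ = (1/2) · [[0, Aᵢ], [Aᵢᵀ, 0]]`. -/
def Bmat {m n p : ℕ} (A : Fin p → Matrix (Fin m) (Fin n) ℝ) (i : Fin p) :
    Matrix (Fin m ⊕ Fin n) (Fin m ⊕ Fin n) ℝ :=
  (1 / 2 : ℝ) • Matrix.fromBlocks 0 (A i) (A i)ᵀ 0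

/-- `(U, V)` is a balanced ("equally-footed") factorization of `X`: for some SVD
`X = A · diagonal S · Bᵀ` (with `A, B` having orthonormal columns and `S` the nonnegative
singular values) and some orthonormal `R`, `U = A · S^{1/2} · R` and `V = B · S^{1/2} · R`. -/
def IsBalanced {m n r : ℕ} (X : Matrix (Fin m) (Fin n) ℝ)
    (U : Matrix (Fin m) (Fin r) ℝ) (V : Matrix (Fin n) (Fin r) ℝ) : Prop :=
  ∃ (A : Matrix (Fin m) (Fin r) ℝ) (B : Matrix (Fin n) (Fin r) ℝ)
    (S : Fin r → ℝ) (R : Matrix (Fin r) (Fin r) ℝ),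
      Aᵀ * A = 1 ∧ Bᵀ * B = 1 ∧ (∀ i, 0 ≤ S i) ∧ Rᵀ * R = 1 ∧ R * Rᵀ = 1 ∧
      X = A * Matrix.diagonal S * Bᵀ ∧
      U = A * Matrix.diagonal (fun i => Real.sqrt (S i)) * R ∧
      V = B * Matrix.diagonal (fun i => Real.sqrt (S i)) * R

/-- `Dist(U, V; X) = min ‖[U; V] − [U*; V*]‖_F` over balanced factorizations `(U*, V*)` of `X`. -/
def distW {m n r : ℕ} (U : Matrix (Fin m) (Fin r) ℝ) (V : Matrix (Fin n) (Fin r) ℝ)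
    (X : Matrix (Fin m) (Fin n) ℝ) : ℝ :=
  sInf {d : ℝ | ∃ (U' : Matrix (Fin m) (Fin r) ℝ) (V' : Matrix (Fin n) (Fin r) ℝ),
    IsBalanced X U' V' ∧ d = fnorm (stack U V - stack U' V')}

/-- First-order optimality condition for `f + g` at `W = [U; V]`:
`∑ᵢ (⟨Bᵢ, WWᵀ⟩ − bᵢ) Bᵢ W + (1/4) W̃ W̃ᵀ W = 0`. -/
def FirstOrderOpt {m n r p : ℕ} (A : Fin p → Matrix (Fin m) (Fin n) ℝ) (b : Fin p → ℝ)
    (U : Matrix (Fin m) (Fin r) ℝ) (V : Matrix (Fin n) (Fin r) ℝ) : Prop :=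
  (∑ i, (ip (Bmat A i) (stack U V * (stack U V)ᵀ) - b i) • (Bmat A i * stack U V))
    + (1 / 4 : ℝ) • (stack U (-V) * (stack U (-V))ᵀ * stack U V) = 0

/-- The Hessian quadratic form of `f + g` at `W = [U; V]` in direction `Z`. -/
def hessForm {m n r p : ℕ} (A : Fin p → Matrix (Fin m) (Fin n) ℝ) (b : Fin p → ℝ)
    (U : Matrix (Fin m) (Fin r) ℝ) (V : Matrix (Fin n) (Fin r) ℝ)
    (Z : Matrix (Fin m ⊕ Fin n) (Fin r) ℝ) : ℝ :=
  (∑ i, ip (Bmat A i) (Z * (stack U V)ᵀ + stack U V * Zᵀ) * ip (Bmat A i) (Z * (stack U V)ᵀ))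
    + (∑ i, (ip (Bmat A i) (stack U V * (stack U V)ᵀ) - b i) * ip (Bmat A i) (Z * Zᵀ))
    + (1 / 4 : ℝ) * ip (tilde Z * (stack U (-V))ᵀ + stack U (-V) * (tilde Z)ᵀ)
        (Z * (stack U V)ᵀ)
    + (1 / 4 : ℝ) * ip (stack U (-V) * (stack U (-V))ᵀ) (Z * Zᵀ)

/-- Second-order optimality condition for `f + g` at `W = [U; V]`: the Hessian quadratic
form is nonnegative in every direction `Z = [Z_U; Z_V]`. -/
def SecondOrderOpt {m n r p : ℕ} (A : Fin p → Matrix (Fin m) (Fin n) ℝ) (b : Fin p → ℝ)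
    (U : Matrix (Fin m) (Fin r) ℝ) (V : Matrix (Fin n) (Fin r) ℝ) : Prop :=
  ∀ Z : Matrix (Fin m ⊕ Fin n) (Fin r) ℝ, 0 ≤ hessForm A b U V Z

theorem sum_sq_ip_smul_add {ι α β : Type*} [Fintype ι] [Fintype α] [Fintype β]
    (A : ι → Matrix α β ℝ) (c d : ℝ) (X Y : Matrix α β ℝ) :
    ∑ i, ip (A i) (c • X + d • Y) ^ 2 = c ^ 2 * ∑ i, ip (A i) X ^ 2 +
      2 * c * d * ∑ i, ip (A i) X * ip (A i) Y + d ^ 2 * ∑ i, ip (A i) Y ^ 2 := by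
  have hlin (i : ι) : ip (A i) (c • X + d • Y) = c * ip (A i) X + d * ip (A i) Y := by
    simp only [ip, Matrix.add_apply, Matrix.smul_apply, smul_eq_mul, Finset.mul_sum,
      ← Finset.sum_add_distrib]
    exact Finset.sum_congr rfl fun _ _ => Finset.sum_congr rfl fun _ _ => by ring
  simp only [hlin, Finset.mul_sum, ← Finset.sum_add_distrib]
  exact Finset.sum_congr rfl fun _ _ => by ring

theorem fnorm_sq {α β : Type*} [Fintype α] [Fintype β] (X : Matrix α β ℝ) :
    fnorm X ^ 2 = ∑ i, ∑ j, X i j ^ 2 :=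
  Real.sq_sqrt (Finset.sum_nonneg fun _ _ => Finset.sum_nonneg fun _ _ => sq_nonneg _)

theorem fnorm_sq_smul_add {α β : Type*} [Fintype α] [Fintype β]
    (c d : ℝ) (X Y : Matrix α β ℝ) :
    fnorm (c • X + d • Y) ^ 2 =
      c ^ 2 * fnorm X ^ 2 + 2 * c * d * ip X Y + d ^ 2 * fnorm Y ^ 2 := by
  simp only [fnorm_sq, ip, Matrix.add_apply, Matrix.smul_apply, smul_eq_mul, Finset.mul_sum,
    ← Finset.sum_add_distrib]
  exact Finset.sum_congr rfl fun _ _ => Finset.sum_congr rfl fun _ _ => by ring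

theorem eq_zero_of_fnorm_eq_zero {α β : Type*} [Fintype α] [Fintype β] {X : Matrix α β ℝ}
    (h : fnorm X = 0) : X = 0 := by
  have hsum : ∑ i, ∑ j, X i j ^ 2 = 0 := by rw [← fnorm_sq, h, zero_pow two_ne_zero]
  have hrows := (Finset.sum_eq_zero_iff_of_nonneg fun _ _ =>
    Finset.sum_nonneg fun _ _ => sq_nonneg _).mp hsum
  refine Matrix.ext fun i j => ?_
  have hrow := (Finset.sum_eq_zero_iff_of_nonneg fun _ _ => sq_nonneg _).mp
    (hrows i (Finset.mem_univ i))
  exact (pow_eq_zero_iff two_ne_zero).mp (hrow j (Finset.mem_univ j))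

theorem rank_add_le_rank_add_rank {m n : ℕ} (X Y : Matrix (Fin m) (Fin n) ℝ) :
    (X + Y).rank ≤ X.rank + Y.rank := by
  have hrank (Z : Matrix (Fin m) (Fin n) ℝ) :
      Z.rank = Module.finrank ℝ (LinearMap.range Z.mulVecLin) := rfl
  rw [hrank, hrank, hrank, Matrix.mulVecLin_add]
  exact (Submodule.finrank_mono (LinearMap.range_add_le _ _)).trans
    (Submodule.finrank_add_le_finrank_add_finrank _ _)

theorem rank_smul_add_smul_le {m n r : ℕ} {X Y : Matrix (Fin m) (Fin n) ℝ}
    (hX : X.rank ≤ r) (hY : Y.rank ≤ r) (c d : ℝ) : (c • X + d • Y).rank ≤ 2 * r := by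
  have hsmul (c : ℝ) (X : Matrix (Fin m) (Fin n) ℝ) : (c • X).rank ≤ X.rank := by
    simpa using Matrix.rank_mul_le_right (c • (1 : Matrix (Fin m) (Fin m) ℝ)) X
  have hadd := rank_add_le_rank_add_rank (c • X) (d • Y)
  have hcX := hsmul c X
  have hdY := hsmul d Y
  omega

/-- RIP implies the approximate-orthogonality property
`|∑ᵢ ⟨Aᵢ, X⟩⟨Aᵢ, Y⟩ − ⟨X, Y⟩| ≤ δ₂ᵣ ‖X‖_F ‖Y‖_F` for rank-`r` matrices `X, Y`. -/
theorem rip_inner_product_bound {m n r p : ℕ}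
    (A : Fin p → Matrix (Fin m) (Fin n) ℝ) (δ2r : ℝ)
    (hRIP : RIP A (2 * r) δ2r)
    (X Y : Matrix (Fin m) (Fin n) ℝ) (hX : X.rank ≤ r) (hY : Y.rank ≤ r) :
    |(∑ i, ip (A i) X * ip (A i) Y) - ip X Y| ≤ δ2r * fnorm X * fnorm Y := by
  rcases eq_or_ne (fnorm X) 0 with ha | ha
  · rw [ha]
    simp [eq_zero_of_fnorm_eq_zero ha, ip]
  rcases eq_or_ne (fnorm Y) 0 with hb | hb
  · rw [hb]
    simp [eq_zero_of_fnorm_eq_zero hb, ip]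
  have hab : 0 < fnorm X * fnorm Y :=
    mul_pos ((Real.sqrt_nonneg _).lt_of_ne' ha) ((Real.sqrt_nonneg _).lt_of_ne' hb)
  have hplus := hRIP _ (rank_smul_add_smul_le hX hY (fnorm Y) (fnorm X))
  have hminus := hRIP _ (rank_smul_add_smul_le hX hY (fnorm Y) (-fnorm X))
  rw [sum_sq_ip_smul_add, fnorm_sq_smul_add] at hplus hminus
  rw [abs_le]
  constructor <;> refine le_of_mul_le_mul_left ?_ hab
  · linarith [hplus.1, hminus.2]
  · linarith [hplus.2, hminus.1]
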